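/- Let d = 2 and let N denote the normal operator of the Euclidean X-ray transform on the closed unit disk, Nf(x) = 2 ∫_{S¹} ∫_0^{τ(x,v)} f(x + tv) dt dσ(v). Then for every x with ‖x‖ < 1, N applied to the function f(y) = (1 − ‖y‖²)^{-1/2} gives the constant 2π²: that is, 2 ∫_{S¹} ∫_0^{τ(x,v)} (1 − ‖x + tv‖²)^{-1/2} dt dσ(v) = 2π². (This is equation (5.4) of the paper, N((1 − r²)^{-1/2}) = c on the unit disk, with the explicit constant.) -/

import Mathlib

open MeasureTheory Metric Set
open scoped RealInnerProductSpace Real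

noncomputable section

/-- The arclength (surface) measure on the unit circle `S¹ ⊂ ℝ²`. -/
def circleMeasure : Measure (Metric.sphere (0 : EuclideanSpace ℝ (Fin 2)) 1) :=
  (volume : Measure (EuclideanSpace ℝ (Fin 2))).toSphere

/-- Exit time `τ(x,v) = -⟨x,v⟩ + √(1 - ‖x‖² + ⟨x,v⟩²)` of the line `t ↦ x + t v`
from the closed unit disk. -/
def exitTime (x v : EuclideanSpace ℝ (Fin 2)) : ℝ :=
  -⟪x, v⟫ + Real.sqrt (1 - ‖x‖ ^ 2 + ⟪x, v⟫ ^ 2)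

/-- The surface measure on the unit sphere induced by an additive Haar measure is invariant under
the antipodal map. -/
theorem measurePreserving_neg_toSphere {E : Type*} [NormedAddCommGroup E] [NormedSpace ℝ E]
    [FiniteDimensional ℝ E] [MeasurableSpace E] [BorelSpace E] (μ : Measure E)
    [μ.IsAddHaarMeasure] :
    MeasurePreserving (fun v : sphere (0 : E) 1 => -v) μ.toSphere μ.toSphere := by
  have hm : Measurable (fun v : sphere (0 : E) 1 => -v) := continuous_neg.measurable
  refine ⟨hm, Measure.ext fun s hs => ?_⟩
  rw [Measure.map_apply hm hs, Measure.toSphere_apply' _ (hm hs), Measure.toSphere_apply' _ hs]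
  congr 1
  rw [← Measure.measure_neg]
  congr 1
  ext y
  simp only [Set.mem_neg, Set.mem_smul, Set.mem_image, Set.mem_preimage]
  constructor
  · rintro ⟨r, hr, _, ⟨v, hv, rfl⟩, h⟩
    refine ⟨r, hr, _, ⟨-v, hv, rfl⟩, ?_⟩
    simp [h]
  · rintro ⟨r, hr, _, ⟨v, hv, rfl⟩, h⟩
    refine ⟨r, hr, _, ⟨-v, by simpa using hv, rfl⟩, ?_⟩
    simp [h]

/-- The integral of `1 / √(A² - (t + s)²)` over `0 < t < A - s`. -/
theorem integral_inv_sqrt_sq_sub_sq {s A : ℝ} (hs : |s| < A) :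
    ∫ t in Ioo 0 (-s + A), (√(A ^ 2 - (t + s) ^ 2))⁻¹ = π / 2 - Real.arcsin (s / A) := by
  have hA : 0 < A := (abs_nonneg s).trans_lt hs
  obtain ⟨hs₁, hs₂⟩ := abs_lt.mp hs
  have hle : 0 ≤ -s + A := by linarith
  have hcont : ContinuousOn (fun t => Real.arcsin ((t + s) / A)) (Icc 0 (-s + A)) := by
    fun_prop
  have hderiv : ∀ t ∈ Ioo 0 (-s + A),
      HasDerivAt (fun t => Real.arcsin ((t + s) / A)) (√(A ^ 2 - (t + s) ^ 2))⁻¹ t := by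
    rintro t ⟨ht₀, ht₁⟩
    have h₁ : (t + s) / A ≠ -1 := by
      rw [ne_eq, div_eq_iff hA.ne']; intro h; linarith
    have h₂ : (t + s) / A ≠ 1 := by
      rw [ne_eq, div_eq_iff hA.ne']; intro h; linarith
    have hlin : HasDerivAt (fun t => (t + s) / A) (1 / A) t :=
      ((hasDerivAt_id t).add_const s).div_const A
    refine ((Real.hasDerivAt_arcsin h₁ h₂).comp t hlin).congr_deriv ?_
    have hsq : A ^ 2 - (t + s) ^ 2 = A ^ 2 * (1 - ((t + s) / A) ^ 2) := by
      field_simp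
    rw [hsq, Real.sqrt_mul (sq_nonneg A), Real.sqrt_sq hA.le, mul_inv]
    ring
  have hint := intervalIntegral.integrableOn_deriv_of_nonneg hcont hderiv
    fun t _ => inv_nonneg.mpr (Real.sqrt_nonneg _)
  rw [← integral_Ioc_eq_integral_Ioo, ← intervalIntegral.integral_of_le hle,
    intervalIntegral.integral_eq_sub_of_hasDerivAt_of_le hle hcont hderiv
      ((intervalIntegrable_iff_integrableOn_Ioc_of_le hle).mpr hint)]
  simp [hA.ne']

/-- The integral of an odd function over the unit sphere vanishes. -/
theorem integral_toSphere_eq_zero_of_odd {E : Type*} [NormedAddCommGroup E] [NormedSpace ℝ E]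
    [FiniteDimensional ℝ E] [MeasurableSpace E] [BorelSpace E] (μ : Measure E)
    [μ.IsAddHaarMeasure] {f : sphere (0 : E) 1 → ℝ} (hf : ∀ v, f (-v) = -f v) :
    ∫ v, f v ∂μ.toSphere = 0 := by
  have h := (measurePreserving_neg_toSphere μ).integral_comp
    (Homeomorph.neg (sphere (0 : E) 1)).measurableEmbedding f
  simp only [hf, integral_neg] at h
  linarith

theorem circleMeasure_real_univ : circleMeasure.real univ = 2 * π := by
  simp [circleMeasure, Measure.real, Measure.toSphere_apply_univ, Real.pi_nonneg]

/-- Equation (5.4) of the paper with explicit constant: on the unit disk, the normal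
operator `N` of the Euclidean X-ray transform applied to `(1-‖y‖²)^{-1/2}` is the
constant `2π²`: for every `‖x‖ < 1`,
`2 ∫_{S¹} ∫_0^{τ(x,v)} (1-‖x+tv‖²)^{-1/2} dt dσ(v) = 2π²`. -/
theorem normal_operator_of_boundary_singular (x : EuclideanSpace ℝ (Fin 2)) (hx : ‖x‖ < 1) :
    2 * ∫ v : Metric.sphere (0 : EuclideanSpace ℝ (Fin 2)) 1,
        (∫ t in Set.Ioo (0 : ℝ) (exitTime x (v : EuclideanSpace ℝ (Fin 2))),
          (Real.sqrt (1 - ‖x + t • (v : EuclideanSpace ℝ (Fin 2))‖ ^ 2))⁻¹)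
        ∂circleMeasure
      = 2 * π ^ 2 := by
  have hpos : ∀ v, 0 < 1 - ‖x‖ ^ 2 + ⟪x, v⟫ ^ 2 := fun v => by
    nlinarith [norm_nonneg x, sq_nonneg ⟪x, v⟫]
  let g : sphere (0 : EuclideanSpace ℝ (Fin 2)) 1 → ℝ := fun v =>
    Real.arcsin (⟪x, (v : EuclideanSpace ℝ (Fin 2))⟫ /
      √(1 - ‖x‖ ^ 2 + ⟪x, (v : EuclideanSpace ℝ (Fin 2))⟫ ^ 2))
  have hinner : ∀ v : sphere (0 : EuclideanSpace ℝ (Fin 2)) 1,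
      ∫ t in Ioo (0 : ℝ) (exitTime x (v : EuclideanSpace ℝ (Fin 2))),
        (√(1 - ‖x + t • (v : EuclideanSpace ℝ (Fin 2))‖ ^ 2))⁻¹ = π / 2 - g v := by
    intro v
    have hv : ‖(v : EuclideanSpace ℝ (Fin 2))‖ = 1 := by simp
    rw [← integral_inv_sqrt_sq_sub_sq]
    · refine integral_congr_ae (.of_forall fun t => ?_)
      dsimp only
      rw [Real.sq_sqrt (hpos v).le, norm_add_sq_real, norm_smul, inner_smul_right, hv,
        Real.norm_eq_abs, mul_one, sq_abs]
      ring_nf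
    · rw [← Real.sqrt_sq_eq_abs]
      exact Real.sqrt_lt_sqrt (sq_nonneg _) (by nlinarith [norm_nonneg x])
  have hodd : ∫ v, g v ∂circleMeasure = 0 :=
    integral_toSphere_eq_zero_of_odd _ fun v => by simp [g, neg_div]
  have hcont : Continuous g := by
    refine Real.continuous_arcsin.comp (Continuous.div (by fun_prop) (by fun_prop) fun v => ?_)
    exact (Real.sqrt_pos.mpr (hpos v)).ne'
  have : IsFiniteMeasure circleMeasure := by unfold circleMeasure; infer_instance
  have hint : Integrable g circleMeasure :=
    hcont.integrable_of_hasCompactSupport (HasCompactSupport.of_compactSpace g)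
  simp_rw [hinner]
  rw [integral_sub (integrable_const _) hint, hodd, integral_const, circleMeasure_real_univ,
    smul_eq_mul]
  ring
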